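/- arXiv:1301.6479 — 3 statements merged into one kernel-verified Lean document; each statement's English description precedes it below -/
import Mathlib

section
/- Let S be a finite relational language and Q a Boolean query on finite nonempty S-structures. Suppose that for all m, n > 0 there exist finite nonempty S-structures D₀ and D₁ with Q(D₀) = 0 and Q(D₁) = 1 such that for every m-coloring B₀ of D₀ there exists an m-coloring B₁ of D₁ with the property that for every subset X of the domain of B₁ with at most n elements, the induced substructure of B₁ on X admits an S_m-homomorphism to B₀. Then Q is not a coFPP query. -/
open FirstOrder

/-- The relational language with `m` unary relation symbols `C₁, …, C_m` (the colors). -/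
def unaryLang (m : ℕ) : Language where
  Functions := fun _ => Empty
  Relations := fun l => match l with
    | 1 => Fin m
    | _ => Empty

instance (m : ℕ) : (unaryLang m).IsRelational :=
  fun _ => inferInstanceAs (IsEmpty Empty)

/-- The structure for `unaryLang m` on `β` in which `Cᵢ` is interpreted by `P i`. -/
def unaryStructure {m : ℕ} {β : Type*} (P : Fin m → β → Prop) : (unaryLang m).Structure β where
  funMap := fun {_} f _ => f.elim
  RelMap := fun {l} r x =>
    match l, r, x with
    | 1, i, x => P i (x 0)

/-- The `i`-th color, as a unary relation symbol of `S_m = S.sum (unaryLang m)`. -/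
def colorRel (S : Language) (m : ℕ) (i : Fin m) : (S.sum (unaryLang m)).Relations 1 :=
  Sum.inr i

/-- An `S_m`-structure is colored if every element satisfies exactly one color `Cᵢ`. -/
def IsColored (S : Language) (m : ℕ) (M : Type*) (iM : (S.sum (unaryLang m)).Structure M) :
    Prop :=
  ∀ x : M, ∃! i : Fin m, iM.RelMap (colorRel S m i) (fun _ => x)

/-- The `m`-coloring of an `S`-structure `D` determined by the color assignment
`c : D → Fin m`, as an `S_m`-structure on the same domain whose `S`-reduct is `D`
(these are precisely the colored `S_m`-structures extending `D`). -/
def coloringStruct (S : Language) {m : ℕ} {D : Type*} [S.Structure D] (c : D → Fin m) :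
    (S.sum (unaryLang m)).Structure D :=
  letI : (unaryLang m).Structure D := unaryStructure (fun i d => c d = i)
  Language.sumStructure S (unaryLang m) D

/-- A Boolean query `Q` on finite nonempty `S`-structures is a coFPP query (the complement
of a forbidden patterns problem) if there are `m ≥ 1` and a finite family `P` of finite
colored `S_m`-structures (the patterns) such that for every finite nonempty `S`-structure
`D`: `Q(D) = 1` iff for every `m`-coloring of `D` (given by `c : D → Fin m`) some pattern
admits an `S_m`-homomorphism into the colored structure. -/
def IsCoFPP (S : Language)
    (Q : ∀ (D : Type), Finite D → Nonempty D → S.Structure D → Prop) : Prop :=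
  ∃ m : ℕ, 1 ≤ m ∧
    ∃ (κ : Type) (_ : Finite κ) (P : κ → Type) (_ : ∀ j, Finite (P j))
      (SP : ∀ j, (S.sum (unaryLang m)).Structure (P j)),
      (∀ j, IsColored S m (P j) (SP j)) ∧
      ∀ (D : Type) (iF : Finite D) (iN : Nonempty D) (iS : S.Structure D),
        (Q D iF iN iS ↔
          ∀ c : D → Fin m, ∃ j,
            Nonempty (@Language.Hom (S.sum (unaryLang m)) (P j) D (SP j)
              (@coloringStruct S m D iS c)))

/-- The structure induced on a subset `X` of a structure over a relational language. -/
def inducedStructure (L : Language) (hL : L.IsRelational) {M : Type*} (iM : L.Structure M)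
    (X : Set M) : L.Structure X where
  funMap := fun {k} f _ => (hL k).elim f
  RelMap := fun {k} r x => iM.RelMap r (fun i => (x i : M))

/-- Let `S` be a finite relational language and `Q` a Boolean query
(isomorphism-invariant) on finite nonempty `S`-structures.  Suppose that for all
`m, n > 0` there are finite nonempty `S`-structures `D₀, D₁` with `Q(D₀) = 0` and
`Q(D₁) = 1` such that for every `m`-coloring `c₀` of `D₀` there is an `m`-coloring `c₁`
of `D₁` such that every induced substructure of the colored structure `B₁` on at most `n`
elements admits an `S_m`-homomorphism to the colored structure `B₀`.
Then `Q` is not a coFPP query. -/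
theorem not_isCoFPP_of_small_substructure_homs
    (S : Language) [S.IsRelational] [Finite S.Symbols]
    (Q : ∀ (D : Type), Finite D → Nonempty D → S.Structure D → Prop)
    (hinv : ∀ (D D' : Type) (iF : Finite D) (iN : Nonempty D) (iS : S.Structure D)
      (iF' : Finite D') (iN' : Nonempty D') (iS' : S.Structure D'),
      Nonempty (@Language.Equiv S D D' iS iS') → (Q D iF iN iS ↔ Q D' iF' iN' iS'))
    (h : ∀ m n : ℕ, 0 < m → 0 < n →
      ∃ (D₀ : Type) (iF₀ : Finite D₀) (iN₀ : Nonempty D₀) (iS₀ : S.Structure D₀)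
        (D₁ : Type) (iF₁ : Finite D₁) (iN₁ : Nonempty D₁) (iS₁ : S.Structure D₁),
        ¬ Q D₀ iF₀ iN₀ iS₀ ∧ Q D₁ iF₁ iN₁ iS₁ ∧
        ∀ c₀ : D₀ → Fin m, ∃ c₁ : D₁ → Fin m,
          ∀ X : Set D₁, Nat.card X ≤ n →
            Nonempty (@Language.Hom (S.sum (unaryLang m)) X D₀
              (inducedStructure (S.sum (unaryLang m)) inferInstance
                (@coloringStruct S m D₁ iS₁ c₁) X)
              (@coloringStruct S m D₀ iS₀ c₀))) :
    ¬ IsCoFPP S Q := by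
  rintro ⟨m, hm, κ, hκ, P, hP, SP, -, hQ⟩
  obtain ⟨n, hn⟩ : ∃ n, ∀ j, Nat.card (P j) ≤ n := by
    obtain ⟨n, hn⟩ := (Set.finite_range (fun j => Nat.card (P j))).bddAbove
    exact ⟨n, fun j => hn ⟨j, rfl⟩⟩
  obtain ⟨D₀, iF₀, iN₀, iS₀, D₁, iF₁, iN₁, iS₁, h0, h1, hc⟩ := h m (n + 1) hm n.succ_pos
  apply h0
  rw [hQ]
  intro c₀
  obtain ⟨c₁, hc₁⟩ := hc c₀
  obtain ⟨j, ⟨f⟩⟩ := (hQ D₁ iF₁ iN₁ iS₁).1 h1 c₁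
  letI := SP j
  letI := @coloringStruct S m D₁ iS₁ c₁
  have hfin := hP j
  obtain ⟨g⟩ := hc₁ (Set.range f.toFun) (by
    have h2 : Nat.card (Set.range f.toFun) ≤ Nat.card (P j) := Finite.card_range_le f.toFun
    have h3 := hn j
    omega)
  letI := @coloringStruct S m D₀ iS₀ c₀
  letI := inducedStructure (S.sum (unaryLang m)) inferInstance
    (@coloringStruct S m D₁ iS₁ c₁) (Set.range f.toFun)
  refine ⟨j, ⟨?_⟩⟩
  refine @Language.Hom.mk _ _ _ (SP j) (@coloringStruct S m D₀ iS₀ c₀)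
    (fun p => g.toFun ⟨f.toFun p, p, rfl⟩) ?_ ?_
  · intro k φ x
    exact isEmptyElim φ
  · intro k r x hx
    exact g.map_rel' r (fun i => ⟨f.toFun (x i), x i, rfl⟩) (f.map_rel' r x hx)
end

section
/- Let S be the relational language with two unary relation symbols A and B and one ternary relation symbol P, and let Q be the Boolean query on finite nonempty S-structures defined by: Q(D) = 1 if and only if there exist n ≥ 2, elements a₁,…,a_n, b of D such that A(a₁) and B(a_n) hold in D and P(aᵢ, b, a_{i+1}) holds in D for all 1 ≤ i < n. Then Q is not a coFPP query. -/
open FirstOrder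

/-- The relational language with two unary relation symbols `A`, `B` (indexed by
`0, 1 : Fin 2`) and one ternary relation symbol `P`. -/
def sigABP : Language where
  Functions := fun _ => Empty
  Relations := fun l => match l with
    | 1 => Fin 2
    | 3 => Unit
    | _ => Empty

/-- The unary relation symbol `A`. -/
def relA : sigABP.Relations 1 := (0 : Fin 2)

/-- The unary relation symbol `B`. -/
def relB : sigABP.Relations 1 := (1 : Fin 2)

/-- The ternary relation symbol `P`. -/
def relP : sigABP.Relations 3 := Unit.unit

/-- Choice between the two unary predicates. -/
def abSel {D : Type} (A B : D → Prop) (i : Fin 2) (x : D) : Prop :=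
  (i = 0 ∧ A x) ∨ (i = 1 ∧ B x)

/-- The structure with prescribed interpretations of `A`, `B`, `P`. -/
def abpStruct {D : Type} (A B : D → Prop) (P : D → D → D → Prop) : sigABP.Structure D where
  funMap := fun {_} f _ => f.elim
  RelMap := fun {l} r x =>
    match l, r, x with
    | 1, i, x => abSel A B i (x 0)
    | 3, _, x => P (x 0) (x 1) (x 2)

theorem hom_transfer {m : ℕ} {M D E : Type} (SM : (sigABP.sum (unaryLang m)).Structure M)
    (A B : D → Prop) (P : D → D → D → Prop) (A' B' : E → Prop) (P' : E → E → E → Prop)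
    (c : D → Fin m) (c' : E → Fin m)
    (f : M → D)
    (hf : ∀ {n} (r : (sigABP.sum (unaryLang m)).Relations n) (x : Fin n → M), SM.RelMap r x →
      (@coloringStruct sigABP m D (abpStruct A B P) c).RelMap r (f ∘ x))
    (g : D → E) (R : Set D) (hR : ∀ x, f x ∈ R)
    (hA : ∀ u ∈ R, A u → A' (g u)) (hB : ∀ u ∈ R, B u → B' (g u))
    (hP : ∀ u ∈ R, ∀ v ∈ R, ∀ w ∈ R, P u v w → P' (g u) (g v) (g w))
    (hc : ∀ u, c' (g u) = c u) :
    Nonempty (@Language.Hom (sigABP.sum (unaryLang m)) M E SM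
      (@coloringStruct sigABP m E (abpStruct A' B' P') c')) := by
  refine ⟨@Language.Hom.mk _ _ _ SM (@coloringStruct sigABP m E (abpStruct A' B' P') c')
    (g ∘ f) ?_ ?_⟩
  · intro n fn x
    rcases fn with fn | fn <;> exact fn.elim
  · intro n r x h
    have h' := hf r x h
    rcases r with r | r
    · match n, r, x, h' with
      | 1, i, x, h' =>
        change abSel A B i (f (x 0)) at h'
        change abSel A' B' i (g (f (x 0)))
        exact h'.imp (fun h => ⟨h.1, hA _ (hR _) h.2⟩) (fun h => ⟨h.1, hB _ (hR _) h.2⟩)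
      | 3, _, x, h' => exact hP _ (hR _) _ (hR _) _ (hR _) h'
    · match n, r, x, h' with
      | 1, i, x, h' =>
        change c (f (x 0)) = i at h'
        change c' (g (f (x 0))) = i
        rw [hc, h']

/-- Domain of the big no-instance: `s`, `t`, the vertices, and the connectors. -/
abbrev Big (V : Type) (n : ℕ) : Type :=
  Fin 2 ⊕ (V ⊕ ((Fin (n + 2) × Fin (n + 2)) ↪ V))

/-- The `x`-th vertex of the `i`-th copy of the path. -/
def pos {V : Type} {n : ℕ} (e : (Fin (n + 2) × Fin (n + 2)) ↪ V) (i x : Fin (n + 2)) : Big V n :=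
  if x.val = 0 then Sum.inl 0 else if x.val = n + 1 then Sum.inl 1 else Sum.inr (Sum.inl (e (i, x)))

/-- The ternary relation of the big no-instance: paths cut at position `i`. -/
def bigP {V : Type} {n : ℕ} (u w v : Big V n) : Prop :=
  ∃ (e : (Fin (n + 2) × Fin (n + 2)) ↪ V) (i x y : Fin (n + 2)),
    1 ≤ i.val ∧ i.val ≤ n ∧ y.val = x.val + 1 ∧ x ≠ i ∧ y ≠ i ∧
    w = Sum.inr (Sum.inr e) ∧ u = pos e i x ∧ v = pos e i y

/-- Left part. -/
def Left {V : Type} {n : ℕ} (e : (Fin (n + 2) × Fin (n + 2)) ↪ V) (u : Big V n) : Prop :=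
  ∃ i x : Fin (n + 2), 1 ≤ i.val ∧ i.val ≤ n ∧ x.val < i.val ∧ u = pos e i x

theorem left_step {V : Type} {n : ℕ} (e : (Fin (n + 2) × Fin (n + 2)) ↪ V) (u v : Big V n)
    (hu : Left e u) (h : bigP u (Sum.inr (Sum.inr e)) v) : Left e v := by
  obtain ⟨i, x, h1, h2, h3, rfl⟩ := hu
  obtain ⟨e', j, x', y', j1, j2, hy, hx', hy', he, hu, rfl⟩ := h
  have : e = e' := by simpa using he
  subst this
  have hjx : x'.val ≠ j.val := fun h => hx' (Fin.ext h)
  have hjy : y'.val ≠ j.val := fun h => hy' (Fin.ext h)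
  refine ⟨j, y', j1, j2, ?_, rfl⟩
  unfold pos at hu
  split_ifs at hu with a1 a2 a3 a4 a5 a6
  all_goals first
    | omega
    | (simp at hu; done)
    | (have := e.injective (Sum.inl.inj (Sum.inr.inj hu))
       simp only [Prod.mk.injEq, Fin.ext_iff] at this
       omega)

theorem left_not_t {V : Type} {n : ℕ} (e : (Fin (n + 2) × Fin (n + 2)) ↪ V) :
    ¬ Left e (Sum.inl 1 : Big V n) := by
  rintro ⟨i, x, h1, h2, h3, h⟩
  unfold pos at h
  split_ifs at h with a1 a2
  · simp at h
  · omega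

/-- The Boolean query `Q` on finite nonempty structures over the
language with unary `A`, `B` and ternary `P`, defined by: `Q(D) = 1` iff there are
`n ≥ 2`, elements `a₁, …, a_n, b` of `D` with `A(a₁)`, `B(a_n)`, and `P(aᵢ, b, aᵢ₊₁)`
for all `1 ≤ i < n` (here `n = k + 2`), is not a coFPP query. -/
theorem query_path_through_b_not_isCoFPP :
    ¬ IsCoFPP sigABP (fun D _ _ iS =>
      ∃ (k : ℕ) (a : Fin (k + 2) → D) (b : D),
        iS.RelMap relA ![a 0] ∧ iS.RelMap relB ![a (Fin.last (k + 1))] ∧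
        ∀ i : Fin (k + 1), iS.RelMap relP ![a i.castSucc, b, a i.succ]) := by
  rintro ⟨m, hm, κ, hκ, Pt, hPt, SP, -, H⟩
  obtain ⟨n, hn⟩ : ∃ n : ℕ, ∀ j, Nat.card (Pt j) < n := by
    obtain ⟨K, hK⟩ := (Set.finite_range fun j => Nat.card (Pt j)).bddAbove
    exact ⟨K + 1, fun j => Nat.lt_succ_of_le (hK ⟨j, rfl⟩)⟩
  let N := m * ((n + 2) * (n + 2)) + 1
  let A : Big (Fin N) n → Prop := fun u => u = Sum.inl 0
  let B : Big (Fin N) n → Prop := fun u => u = Sum.inl 1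
  -- the big structure is a no-instance
  have hno := (H (Big (Fin N) n) inferInstance inferInstance (abpStruct A B bigP)).not.1 (by
    rintro ⟨k, a, b, hA, hB, hP⟩
    replace hA : a 0 = Sum.inl 0 := by
      rcases (show abSel A B 0 (a 0) from hA) with h | h
      · exact h.2
      · simp at h
    replace hB : a (Fin.last (k + 1)) = Sum.inl 1 := by
      rcases (show abSel A B 1 (a (Fin.last (k + 1))) from hB) with h | h
      · simp at h
      · exact h.2
    replace hP : ∀ i : Fin (k + 1), bigP (a i.castSucc) b (a i.succ) := hP
    obtain ⟨e, i, x, y, i1, i2, -, -, -, rfl, -, -⟩ := hP 0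
    have hl : ∀ q : Fin (k + 2), Left e (a q) := by
      intro q
      induction q using Fin.induction with
      | zero => exact ⟨i, 0, i1, i2, lt_of_lt_of_le Nat.zero_lt_one i1, by simp [hA, pos]⟩
      | succ q ih => exact left_step e _ _ ih (hP q)
    have := hl (Fin.last (k + 1))
    rw [hB] at this
    exact left_not_t e this)
  push Not at hno
  obtain ⟨c, hc⟩ := hno
  -- a large monochromatic set of vertices
  obtain ⟨γ, hγ⟩ : ∃ γ : Fin m, (n + 2) * (n + 2) <
      (Finset.univ.filter fun v : Fin N => c (Sum.inr (Sum.inl v)) = γ).card :=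
    Fintype.exists_lt_card_fiber_of_mul_lt_card
      (fun v : Fin N => c (Sum.inr (Sum.inl v))) (by simp [N])
  obtain ⟨e, he⟩ : ∃ e : (Fin (n + 2) × Fin (n + 2)) ↪ Fin N,
      ∀ p, c (Sum.inr (Sum.inl (e p))) = γ := by
    obtain ⟨e⟩ : Nonempty ((Fin (n + 2) × Fin (n + 2)) ↪
        {v : Fin N // v ∈ Finset.univ.filter fun v : Fin N => c (Sum.inr (Sum.inl v)) = γ}) := by
      apply Function.Embedding.nonempty_of_card_le
      rw [Fintype.card_coe]
      simpa using hγ.le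
    exact ⟨e.trans (Function.Embedding.subtype _), fun p => (Finset.mem_filter.1 (e p).2).2⟩
  have hcol : ∀ i i' x, c (pos e i x) = c (pos e i' x) := by
    intro i i' x
    unfold pos
    split_ifs <;> simp [he]
  -- the path
  let A' : Option (Fin (n + 2)) → Prop := fun u => u = some 0
  let B' : Option (Fin (n + 2)) → Prop := fun u => u = some (Fin.last (n + 1))
  let P' : Option (Fin (n + 2)) → Option (Fin (n + 2)) → Option (Fin (n + 2)) → Prop :=
    fun u w v => w = none ∧ ∃ x y : Fin (n + 2), y.val = x.val + 1 ∧ u = some x ∧ v = some y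
  have hyes := (H (Option (Fin (n + 2))) inferInstance inferInstance (abpStruct A' B' P')).1
    ⟨n, some, none, Or.inl ⟨rfl, rfl⟩, Or.inr ⟨rfl, rfl⟩, fun i => ⟨rfl, i.castSucc, i.succ, by simp, rfl, rfl⟩⟩
  let g : Fin (n + 2) → Option (Fin (n + 2)) → Big (Fin N) n := fun i u =>
    u.elim (Sum.inr (Sum.inr e)) (pos e i)
  obtain ⟨j, ⟨⟨f, -, hf⟩⟩⟩ := hyes (fun u => c (g 0 u))
  have hfin := hPt j
  -- a missed position
  obtain ⟨i, i1, i2, hi⟩ : ∃ i : Fin (n + 2), 1 ≤ i.val ∧ i.val ≤ n ∧ ∀ x, f x ≠ some i := by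
    by_contra hcon
    push Not at hcon
    have h' : ∀ q : Fin n, ∃ x, f x = some (⟨q.val + 1, by omega⟩ : Fin (n + 2)) :=
      fun q => hcon ⟨q.val + 1, by omega⟩ (by simp) (by simp only []; omega)
    choose z hz using h'
    have hinj : Function.Injective z := by
      intro q q' hq
      have h1 := hz q
      rw [hq, hz q'] at h1
      simp only [Option.some.injEq, Fin.mk.injEq] at h1
      exact Fin.ext (by omega)
    have := Nat.card_le_card_of_injective z hinj
    have h2 := hn j
    simp at this
    omega
  have := hom_transfer (SP j) A' B' P' A B bigP (fun u => c (g 0 u)) c f hf (g i) {u | u ≠ some i} hi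
    (by rintro u - rfl; simp [A, g, pos])
    (by rintro u - rfl; simp [B, g, pos])
    (by
      rintro u hu w - v hv ⟨rfl, x, y, hxy, rfl, rfl⟩
      exact ⟨e, i, x, y, i1, i2, hxy, fun h => hu (by rw [h]), fun h => hv (by rw [h]),
        rfl, rfl, rfl⟩)
    (by
      rintro (_ | x)
      · rfl
      · exact hcol _ _ _)
  exact (not_nonempty_iff.2 (hc j)) this
end

section
/- Let S be the relational language with two binary relation symbols R and S₀, and let Q be the Boolean query on finite nonempty S-structures defined by: Q(D) = 1 if and only if there exist elements x, y of D such that (x, y) lies in the transitive closure of the relation R^D and (x, y) lies in the transitive closure of the relation S₀^D. Then Q is not a coFPP query. -/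
open FirstOrder

/-- The relational language with two binary relation symbols `R` (index `0`) and `S₀`
(index `1`). -/
def sigRS : Language where
  Functions := fun _ => Empty
  Relations := fun l => match l with
    | 2 => Fin 2
    | _ => Empty

/-- The binary relation symbol `R`. -/
def relR : sigRS.Relations 2 := (0 : Fin 2)

/-- The binary relation symbol `S₀`. -/
def relS : sigRS.Relations 2 := (1 : Fin 2)

/-- The `sigRS`-structure given by two binary relations. -/
def mkRS {D : Type} (E : Fin 2 → D → D → Prop) : sigRS.Structure D where
  funMap := fun {_} f _ => f.elim
  RelMap := fun {l} r x =>
    match l, r, x with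
    | 2, r, x => E r (x 0) (x 1)

/-- A homomorphism `f` into a colored structure on `A` can be composed with any color-preserving
map `g : A → B` which preserves the relations between elements of the range of `f`. -/
lemma transfer_hom {m : ℕ} {P A B : Type} (SP : (sigRS.sum (unaryLang m)).Structure P)
    (EA : Fin 2 → A → A → Prop) (EB : Fin 2 → B → B → Prop) (cA : A → Fin m) (cB : B → Fin m)
    (h : @Language.Hom (sigRS.sum (unaryLang m)) P A SP (@coloringStruct sigRS m A (mkRS EA) cA)) :
    ∃ f : P → A, ∀ g : A → B, (∀ a, cB (g a) = cA a) →
      (∀ r p q, EA r (f p) (f q) → EB r (g (f p)) (g (f q))) →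
      Nonempty (@Language.Hom (sigRS.sum (unaryLang m)) P B SP
        (@coloringStruct sigRS m B (mkRS EB) cB)) := by
  let f : P → A := @Language.Hom.toFun _ _ _ SP (@coloringStruct sigRS m A (mkRS EA) cA) h
  refine ⟨f, fun g hc hE => ⟨@Language.Hom.mk _ _ _ SP (@coloringStruct sigRS m B (mkRS EB) cB)
    (fun p => g (f p)) ?_ ?_⟩⟩
  · intro n f
    rcases f with f | f <;> exact f.elim
  · intro n r x hx
    have := @Language.Hom.map_rel' _ _ _ SP (@coloringStruct sigRS m A (mkRS EA) cA) h n r x hx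
    rcases r with r | r
    · match n, r, x, this with
      | 2, r, x, this => exact hE r _ _ this
    · match n, r, x, this with
      | 1, r, x, this => exact (hc _).trans this

theorem query_transitive_closures_meet_not_isCoFPP :
    ¬ IsCoFPP sigRS (fun D _ _ iS =>
      ∃ x y : D,
        Relation.TransGen (fun u v => iS.RelMap relR ![u, v]) x y ∧
        Relation.TransGen (fun u v => iS.RelMap relS ![u, v]) x y) := by
  rintro ⟨m, hm, κ, hκ, P, hP, SP, -, H⟩
  obtain ⟨K, hK⟩ : ∃ K, ∀ j, Nat.card (P j) ≤ K := by
    obtain ⟨K, hK⟩ := (Set.finite_range (fun j => Nat.card (P j))).bddAbove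
    exact ⟨K, fun j => hK ⟨j, rfl⟩⟩
  -- paths have vertices `0, …, K + 2`
  let V := Fin (K + 3)
  let I := Option (V → Fin m)
  let EB : Fin 2 → I × V → I × V → Prop := fun r p q =>
    if r = 0 then p.1 = q.1 ∧ p.2.val + 1 = q.2.val
    else p.1 ≠ q.1 ∧ p.2.val = 0 ∧ q.2.val = K + 2
  let EA : Fin 2 → V → V → Prop := fun r p q =>
    if r = 0 then p.val + 1 = q.val
    else p.val = 0 ∧ q.val = K + 2
  have hB := H (I × V) inferInstance ⟨(none, 0)⟩ (mkRS EB)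
  have hA := H V inferInstance ⟨0⟩ (mkRS EA)
  have hnB : ¬ ∃ x y : I × V,
        Relation.TransGen (fun u v => (mkRS EB).RelMap relR ![u, v]) x y ∧
        Relation.TransGen (fun u v => (mkRS EB).RelMap relS ![u, v]) x y := by
    rintro ⟨x, y, h1, h2⟩
    have e1 : x.1 = y.1 := by
      clear h2
      induction h1 with
      | single h => exact (show _ ∧ _ from h).1
      | tail _ h ih => exact ih.trans (show _ ∧ _ from h).1
    have e2 : x.1 ≠ y.1 ∧ y.2.val = K + 2 := by
      clear h1 e1
      induction h2 with
      | single h =>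
        have h' : _ ≠ _ ∧ _ ∧ _ := h
        exact ⟨h'.1, h'.2.2⟩
      | @tail b c _ h ih =>
        have h' : b.1 ≠ c.1 ∧ b.2.val = 0 ∧ c.2.val = K + 2 := h
        omega
    exact e2.1 e1
  have hyA : ∃ x y : V,
        Relation.TransGen (fun u v => (mkRS EA).RelMap relR ![u, v]) x y ∧
        Relation.TransGen (fun u v => (mkRS EA).RelMap relS ![u, v]) x y := by
    refine ⟨⟨0, by omega⟩, ⟨K + 2, by omega⟩, ?_, .single ?_⟩
    · have : ∀ n (hn : n + 1 < K + 3), Relation.TransGen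
          (fun u v : V => (mkRS EA).RelMap relR ![u, v]) ⟨0, by omega⟩ ⟨n + 1, hn⟩ := by
        intro n
        induction n with
        | zero => intro hn; exact .single (show 0 + 1 = 0 + 1 from rfl)
        | succ n ih =>
          intro hn
          exact .tail (ih (by omega)) (show n + 1 + 1 = n + 1 + 1 from rfl)
      exact this (K + 1) (by omega)
    · exact (show 0 = 0 ∧ K + 2 = K + 2 from ⟨rfl, rfl⟩)
  replace hnB := mt hB.2 hnB
  push Not at hnB
  obtain ⟨c, hc⟩ := hnB
  -- pigeonhole: two equally colored paths
  obtain ⟨i, j, hij, hcol⟩ : ∃ i j : I, i ≠ j ∧ (fun v => c (i, v)) = fun v => c (j, v) := by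
    classical
    exact Fintype.exists_ne_map_eq_of_card_lt (fun (i : I) (v : V) => c (i, v))
      (by simp only [I, Fintype.card_option]; omega)
  obtain ⟨t, ⟨h⟩⟩ := hA.1 hyA (fun v => c (i, v))
  obtain ⟨e, he⟩ := transfer_hom (SP t) EA EB _ c h
  -- an interior vertex is missed
  obtain ⟨w, hw⟩ : ∃ w : Fin (K + 1), ∀ p, (e p).val ≠ w.val + 1 := by
    by_contra! hcon
    choose f hf using hcon
    have hinj : Function.Injective f := by
      intro a b hab
      have := hf a
      rw [hab, hf b] at this
      exact Fin.ext (by omega)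
    have := Nat.card_le_card_of_injective f hinj
    have := hK t
    simp only [Nat.card_eq_fintype_card, Fintype.card_fin] at *
    omega
  have hwlt := w.isLt
  have := he (fun v => if v.val ≤ w.val + 1 then (i, v) else (j, v)) ?_ ?_
  · exact (hc t).elim this.some
  · intro v
    have := congrFun hcol v
    split_ifs
    · rfl
    · exact this.symm
  · intro r p q hpq
    have h1 := hw p
    have h2 := hw q
    generalize e p = a at *
    generalize e q = b at *
    simp only [EA, EB] at hpq ⊢
    split_ifs at hpq ⊢ <;> first | omega | simp_all
end
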